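/- Let u, v ∈ ℕ and let M be a u × v matrix with entries from ℝ⁺ ∪ {0} which is image partition regular over ℝ⁺. If C ⊆ ℝ⁺ is a piecewise syndetic* (PS*) set near zero in ℝ⁺, then {x ∈ (ℝ⁺)^v : M·x ∈ C^u} is a PS* set near zero in (ℝ⁺)^v. -/

import Mathlib

open Set Filter

attribute [local instance] Ultrafilter.add Ultrafilter.addSemigroup

/-- The positive reals `ℝ⁺ = (0,∞)` as a type, a discrete additive semigroup. -/
abbrev Rpos : Type := {x : ℝ // 0 < x}

/-- `0⁺(ℝ⁺)`: ultrafilters on `ℝ⁺` containing `(0,ε)` for every `ε > 0`. -/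
def zeroPlus1 : Set (Ultrafilter Rpos) :=
  {p | ∀ ε : ℝ, 0 < ε → {x : Rpos | (x : ℝ) < ε} ∈ p}

/-- `0⁺((ℝ⁺)^v)`: ultrafilters on `(ℝ⁺)^v` containing `(0,ε)^v` for every `ε > 0`. -/
def zeroPlusV (v : ℕ) : Set (Ultrafilter (Fin v → Rpos)) :=
  {p | ∀ ε : ℝ, 0 < ε → {x : Fin v → Rpos | ∀ j, (x j : ℝ) < ε} ∈ p}

/-- `I` is a (nonempty, two-sided) ideal of the subsemigroup `T` of the ultrafilter
semigroup `βγ`. -/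
def IsIdealIn {γ : Type} [AddSemigroup γ] (T I : Set (Ultrafilter γ)) : Prop :=
  I.Nonempty ∧ I ⊆ T ∧ (∀ p ∈ T, ∀ q ∈ I, p + q ∈ I) ∧ ∀ p ∈ T, ∀ q ∈ I, q + p ∈ I

/-- `p` belongs to the smallest two-sided ideal `K(T)` of `T`: equivalently, `p ∈ T` and
`p` belongs to every nonempty two-sided ideal of `T`. -/
def memK {γ : Type} [AddSemigroup γ] (T : Set (Ultrafilter γ)) (p : Ultrafilter γ) : Prop :=
  p ∈ T ∧ ∀ I : Set (Ultrafilter γ), IsIdealIn T I → p ∈ I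

/-- `M` is image partition regular over `ℝ⁺` (IPR/ℝ⁺): whenever `ℝ⁺` is partitioned into
finitely many cells, there are a cell `i` and `x ∈ (ℝ⁺)^v` such that every entry of `M·x`
lies in `ℝ⁺` and in the cell `i`. -/
def IPR {u v : ℕ} (M : Fin u → Fin v → ℝ) : Prop :=
  ∀ (r : ℕ) (c : Rpos → Fin r), ∃ (i : Fin r) (x : Fin v → Rpos),
    ∀ k : Fin u, ∃ h : 0 < ∑ j, M k j * (x j : ℝ), c ⟨∑ j, M k j * (x j : ℝ), h⟩ = i

/-- `A ⊆ ℝ⁺` is a *piecewise syndetic\* (PS\*) set near zero*: `A` belongs to every member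
of `K(0⁺(ℝ⁺))`. -/
def PSStar1 (A : Set Rpos) : Prop :=
  ∀ p : Ultrafilter Rpos, memK zeroPlus1 p → A ∈ p

/-- `A ⊆ (ℝ⁺)^v` is a *piecewise syndetic\* (PS\*) set near zero*: `A` belongs to every
member of `K(0⁺((ℝ⁺)^v))`. -/
def PSStarV (v : ℕ) (A : Set (Fin v → Rpos)) : Prop :=
  ∀ p : Ultrafilter (Fin v → Rpos), memK (zeroPlusV v) p → A ∈ p

/-- The image of a sum of ultrafilters under a semigroup homomorphism is the sum of the images. -/
theorem Ultrafilter.map_add_of_hom {γ δ : Type} [AddSemigroup γ] [AddSemigroup δ]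
    (f : γ →ₙ+ δ) (p q : Ultrafilter γ) : (p + q).map f = p.map f + q.map f := by
  ext A
  have h₁ := Ultrafilter.eventually_add p q (fun x => f x ∈ A)
  have h₂ := Ultrafilter.eventually_add (p.map f) (q.map f) (fun x => x ∈ A)
  simp only [map_add] at h₁
  exact h₁.trans h₂.symm

/-- A homomorphism whose extension maps `T` onto `U` maps `K(T)` into `K(U)`. -/
theorem memK.map {γ δ : Type} [AddSemigroup γ] [AddSemigroup δ] (f : γ →ₙ+ δ)
    {T : Set (Ultrafilter γ)} {U : Set (Ultrafilter δ)}
    (hT : ∀ p ∈ T, ∀ q ∈ T, p + q ∈ T) (hmaps : ∀ p ∈ T, p.map f ∈ U)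
    (hsurj : ∀ q ∈ U, ∃ p ∈ T, p.map f = q) {p : Ultrafilter γ} (hp : memK T p) :
    memK U (p.map f) := by
  refine ⟨hmaps p hp.1, fun I ⟨⟨q, hq⟩, hsub, hl, hr⟩ => ?_⟩
  refine (hp.2 {r | r ∈ T ∧ r.map f ∈ I} ⟨?_, fun r hr => hr.1, ?_, ?_⟩).2
  · obtain ⟨r, hrT, rfl⟩ := hsurj q (hsub hq)
    exact ⟨r, hrT, hq⟩
  · rintro a ha b ⟨hbT, hbI⟩
    refine ⟨hT a ha b hbT, ?_⟩
    rw [Ultrafilter.map_add_of_hom]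
    exact hl _ (hmaps a ha) _ hbI
  · rintro a ha b ⟨hbT, hbI⟩
    refine ⟨hT b hbT a ha, ?_⟩
    rw [Ultrafilter.map_add_of_hom]
    exact hr _ (hmaps a ha) _ hbI

/-- `0⁺((ℝ⁺)^v)` is closed under addition. -/
theorem add_mem_zeroPlusV {v : ℕ} (p : Ultrafilter (Fin v → Rpos)) (hp : p ∈ zeroPlusV v)
    (q : Ultrafilter (Fin v → Rpos)) (hq : q ∈ zeroPlusV v) : p + q ∈ zeroPlusV v := by
  intro ε hε
  refine (Ultrafilter.eventually_add p q (fun x => ∀ j, (x j : ℝ) < ε)).2 ?_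
  filter_upwards [hp (ε / 2) (half_pos hε)] with x hx
  filter_upwards [hq (ε / 2) (half_pos hε)] with y hy j
  have h₁ : (x j : ℝ) < ε / 2 := hx j
  have h₂ : (y j : ℝ) < ε / 2 := hy j
  have h₃ : ((x + y) j : ℝ) = x j + y j := rfl
  linarith

/-- The linear form `x ↦ ∑ j, a j * x j`, as a homomorphism `(ℝ⁺)^v → ℝ⁺`. -/
def rowHom {v : ℕ} (a : Fin v → ℝ) (ha : ∀ x : Fin v → Rpos, 0 < ∑ j, a j * (x j : ℝ)) :
    (Fin v → Rpos) →ₙ+ Rpos where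
  toFun x := ⟨∑ j, a j * (x j : ℝ), ha x⟩
  map_add' x y := by
    apply Subtype.ext
    simp [mul_add, Finset.sum_add_distrib]

/-- A positive linear form maps `K(0⁺((ℝ⁺)^v))` into `K(0⁺(ℝ⁺))`. -/
theorem memK_map_rowHom {v : ℕ} (a : Fin v → ℝ) (hnn : ∀ j, 0 ≤ a j)
    (ha : ∀ x : Fin v → Rpos, 0 < ∑ j, a j * (x j : ℝ)) {p : Ultrafilter (Fin v → Rpos)}
    (hp : memK (zeroPlusV v) p) : memK zeroPlus1 (p.map (rowHom a ha)) := by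
  have hS : 0 < ∑ j, a j := by simpa using ha (fun _ => ⟨1, one_pos⟩)
  refine hp.map (U := zeroPlus1) (rowHom a ha) add_mem_zeroPlusV (fun q hq ε hε => ?_)
    (fun q hq => ?_)
  · refine Ultrafilter.mem_map.2 ?_
    filter_upwards [hq (ε / (2 * ∑ j, a j)) (by positivity)] with x hx
    have hle : ∑ j, a j * (x j : ℝ) ≤ ∑ j, a j * (ε / (2 * ∑ j, a j)) :=
      Finset.sum_le_sum fun j _ => mul_le_mul_of_nonneg_left (le_of_lt (hx j)) (hnn j)
    rw [← Finset.sum_mul] at hle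
    have heq : (∑ j, a j) * (ε / (2 * ∑ j, a j)) = ε / 2 := by field_simp
    change ∑ j, a j * (x j : ℝ) < ε
    linarith
  · let s : Rpos → Fin v → Rpos := fun t _ => ⟨t / ∑ j, a j, div_pos t.2 hS⟩
    refine ⟨q.map s, fun ε hε => ?_, ?_⟩
    · refine Ultrafilter.mem_map.2 ?_
      filter_upwards [hq (ε * ∑ j, a j) (mul_pos hε hS)] with t ht j
      exact (div_lt_iff₀ hS).2 ht
    · have hs : rowHom a ha ∘ s = id := by
        funext t
        apply Subtype.ext
        change ∑ j, a j * ((t : ℝ) / ∑ j, a j) = t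
        rw [← Finset.sum_mul]
        field_simp
      rw [Ultrafilter.map_map, hs, Ultrafilter.map_id]

/-- If `M` is a `u × v` matrix with entries from `ℝ⁺ ∪ {0}` which is IPR/ℝ⁺ and `C ⊆ ℝ⁺`
is a PS\* set near zero in `ℝ⁺`, then `{x ∈ (ℝ⁺)^v : M·x ∈ C^u}` is a PS\* set near zero
in `(ℝ⁺)^v`. -/
theorem psStar_preserved {u v : ℕ} (hu : 1 ≤ u) (hv : 1 ≤ v)
    (M : Fin u → Fin v → ℝ) (hMnn : ∀ i j, 0 ≤ M i j) (hIPR : IPR M)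
    (C : Set ℝ) (hC : C ⊆ Set.Ioi 0) (hPS : PSStar1 {a : Rpos | (a : ℝ) ∈ C}) :
    PSStarV v {x : Fin v → Rpos | ∀ i : Fin u, (∑ j, M i j * (x j : ℝ)) ∈ C} := by
  have hpos : ∀ i, ∀ x : Fin v → Rpos, 0 < ∑ j, M i j * (x j : ℝ) := by
    obtain ⟨_, y, hy⟩ := hIPR 1 (fun _ => 0)
    intro i x
    obtain ⟨j, -, hj⟩ := Finset.exists_lt_of_sum_lt
      (show ∑ _j : Fin v, (0 : ℝ) < ∑ j, M i j * (y j : ℝ) by simpa using (hy i).1)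
    exact Finset.sum_pos' (fun k _ => mul_nonneg (hMnn i k) (x k).2.le)
      ⟨j, Finset.mem_univ j, mul_pos (pos_of_mul_pos_left hj (y j).2.le) (x j).2⟩
  intro p hp
  exact Filter.eventually_all.2 fun i =>
    hPS _ (memK_map_rowHom (M i) (hMnn i) (hpos i) hp)
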